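/- arXiv:0704.3921 — 2 statements merged into one kernel-verified Lean document; each statement's English description precedes it below -/
import Mathlib

section
/- Let X be a normed vector space, let F, G, M, E : X → ℝ be continuous functionals, and let f : ℝ × ℝ → ℝ be continuous. Suppose d := inf{ F(u) : u ∈ X, u ≠ 0, G(u) = 0 } satisfies d > 0, and suppose that whenever u ≠ 0 and G(u) = 0 one has F(u) ≤ f(M(u), E(u)). Let T ∈ (0, ∞], and let Φ : [0,T) → X be continuous with Φ(t) ≠ 0 for all t, and with M(Φ(t)) = M(Φ(0)) and E(Φ(t)) = E(Φ(0)) for all t ∈ [0,T). If f(M(Φ(0)), E(Φ(0))) < d, then: (i) if G(Φ(0)) > 0 then G(Φ(t)) > 0 for all t ∈ [0,T); (ii) if G(Φ(0)) < 0 then G(Φ(t)) < 0 for all t ∈ [0,T). -/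
open scoped ENNReal

/-- abstract invariant-set principle. Let `X` be a normed vector space,
`F, G, M, E : X → ℝ` continuous, `f : ℝ × ℝ → ℝ` continuous. Suppose
`d := inf { F u : u ≠ 0, G u = 0 }` is positive and `F u ≤ f (M u, E u)` whenever `u ≠ 0`,
`G u = 0`. Let `T ∈ (0, ∞]` and let `Φ` be continuous and nonvanishing on `[0, T)`, conserving
`M` and `E`. If `f (M (Φ 0), E (Φ 0)) < d`, then the sign of `G` along the flow is preserved. -/
theorem invariant_sets
    {X : Type*} [NormedAddCommGroup X] [NormedSpace ℝ X]
    (F G M E : X → ℝ) (hF : Continuous F) (hG : Continuous G)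
    (hM : Continuous M) (hE : Continuous E)
    (f : ℝ × ℝ → ℝ) (hf : Continuous f)
    (d : ℝ) (hd : d = sInf { y | ∃ u : X, u ≠ 0 ∧ G u = 0 ∧ y = F u }) (hdpos : 0 < d)
    (hFf : ∀ u : X, u ≠ 0 → G u = 0 → F u ≤ f (M u, E u))
    (T : ℝ≥0∞) (hT : 0 < T) (Φ : ℝ → X)
    (S : Set ℝ) (hS : S = { t : ℝ | 0 ≤ t ∧ ENNReal.ofReal t < T })
    (hΦcont : ContinuousOn Φ S)
    (hΦne : ∀ t ∈ S, Φ t ≠ 0)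
    (hMcons : ∀ t ∈ S, M (Φ t) = M (Φ 0))
    (hEcons : ∀ t ∈ S, E (Φ t) = E (Φ 0))
    (hlt : f (M (Φ 0), E (Φ 0)) < d) :
    (0 < G (Φ 0) → ∀ t ∈ S, 0 < G (Φ t)) ∧
    (G (Φ 0) < 0 → ∀ t ∈ S, G (Φ t) < 0) := by
  have hbdd : BddBelow { y | ∃ u : X, u ≠ 0 ∧ G u = 0 ∧ y = F u } := by
    by_contra h
    rw [hd, Real.sInf_of_not_bddBelow h] at hdpos
    exact lt_irrefl 0 hdpos
  have hGne : ∀ t ∈ S, G (Φ t) ≠ 0 := by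
    intro t ht h0
    have hdF : d ≤ F (Φ t) := hd ▸ csInf_le hbdd ⟨Φ t, hΦne t ht, h0, rfl⟩
    have hFle := hFf (Φ t) (hΦne t ht) h0
    rw [hMcons t ht, hEcons t ht] at hFle
    linarith
  have h0S : (0 : ℝ) ∈ S := by
    rw [hS]
    exact ⟨le_rfl, by simpa using hT⟩
  have hSconn : IsPreconnected S := by
    have : S.OrdConnected := by
      rw [hS]
      exact ⟨fun a ha b hb c hc =>
        ⟨ha.1.trans hc.1, (ENNReal.ofReal_le_ofReal hc.2).trans_lt hb.2⟩⟩
    exact this.isPreconnected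
  have hcont : ContinuousOn (fun t => G (Φ t)) S := hG.comp_continuousOn hΦcont
  constructor
  · intro hpos t ht
    by_contra! hle
    obtain ⟨s, hs, hs0⟩ := hSconn.intermediate_value ht h0S hcont ⟨hle, hpos.le⟩
    exact hGne s hs hs0
  · intro hneg t ht
    by_contra! hle
    obtain ⟨s, hs, hs0⟩ := hSconn.intermediate_value h0S ht hcont ⟨hneg.le, hle⟩
    exact hGne s hs hs0
end

section
/- Let φ : 𝕊² → ℂ be a C¹ function that is antisymmetric about the equator. Then ‖φ‖₂ ≤ 4 ‖∇_{𝕊²}φ‖₂, i.e., ∫_{𝕊²}|φ|² dσ ≤ 16 ∫_{𝕊²}|∇_{𝕊²}φ|² dσ. -/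
open MeasureTheory Finset
open scoped RealInnerProductSpace

noncomputable section

abbrev E3 := EuclideanSpace ℝ (Fin 3)

/-- The unit sphere `𝕊² ⊆ ℝ³`. -/
def S2 : Set E3 := Metric.sphere (0 : E3) 1

/-- Reflection across the equatorial plane `{x₃ = 0}`. -/
def negz (x : E3) : E3 := (WithLp.equiv 2 (Fin 3 → ℝ)).symm
  (fun i => if i = 2 then -(x i) else x i)

/-- `φ` is antisymmetric about the equator of `𝕊²`. -/
def Antisym (φ : E3 → ℂ) : Prop := ∀ x ∈ S2, φ (negz x) = -φ x

/-- Orthogonal projection of `v` onto the tangent plane of the unit sphere at `x`. -/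
def tangProj (x v : E3) : E3 := v - ⟪x, v⟫ • x

/-- `|∇_{𝕊²}φ|²(x)`: the squared norm of the tangential (intrinsic) gradient of `φ` at `x`,
computed from the ambient derivative of a `C¹` extension. -/
def tGradSq (φ : E3 → ℂ) (x : E3) : ℝ :=
  ∑ i : Fin 3, ‖fderiv ℝ φ x (tangProj x (EuclideanSpace.single i (1 : ℝ)))‖ ^ 2

/-- The square of an integral is at most the length of the interval times the integral of the
square. -/
lemma sq_intervalIntegral_le {g : ℝ → ℝ} (hg : Continuous g) {a b : ℝ} (hab : a ≤ b) :
    (∫ t in a..b, g t) ^ 2 ≤ (b - a) * ∫ t in a..b, g t ^ 2 := by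
  rcases hab.eq_or_lt with rfl | hlt
  · simp
  set G := ∫ t in a..b, g t
  have h0 : 0 ≤ ∫ t in a..b, ((b - a) * g t - G) ^ 2 :=
    intervalIntegral.integral_nonneg hab fun t _ => sq_nonneg _
  have h1 : ∫ t in a..b, ((b - a) * g t - G) ^ 2
      = (b - a) ^ 2 * (∫ t in a..b, g t ^ 2) - 2 * (b - a) * G * G + (b - a) * G ^ 2 := by
    have : ∀ t, ((b - a) * g t - G) ^ 2
        = (b - a) ^ 2 * g t ^ 2 - 2 * (b - a) * G * g t + G ^ 2 := fun t => by ring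
    simp_rw [this]
    rw [intervalIntegral.integral_add, intervalIntegral.integral_sub,
      intervalIntegral.integral_const_mul, intervalIntegral.integral_const_mul,
      intervalIntegral.integral_const, smul_eq_mul]
    all_goals exact Continuous.intervalIntegrable (by fun_prop) _ _
  have h2 : 0 ≤ (b - a) * ((b - a) * (∫ t in a..b, g t ^ 2) - G ^ 2) := by
    rw [h1] at h0
    linarith
  linarith [nonneg_of_mul_nonneg_right h2 (sub_pos.2 hlt)]

/-- A Poincaré inequality on an interval for functions vanishing at the left endpoint. -/
lemma intervalIntegral_norm_sq_le {E : Type*} [NormedAddCommGroup E] [NormedSpace ℝ E]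
    [CompleteSpace E] {f f' : ℝ → E} (hf : ∀ t, HasDerivAt f (f' t) t)
    (hf' : Continuous f') {a b : ℝ} (hab : a ≤ b) (ha : f a = 0) :
    ∫ t in a..b, ‖f t‖ ^ 2 ≤ (b - a) ^ 2 * ∫ t in a..b, ‖f' t‖ ^ 2 := by
  have hfc : Continuous f := continuous_iff_continuousAt.2 fun t => (hf t).continuousAt
  have key : ∀ t ∈ Set.Icc a b, ‖f t‖ ^ 2 ≤ (b - a) * ∫ s in a..b, ‖f' s‖ ^ 2 := by
    intro t ht
    have h1 : ∫ s in a..t, f' s = f t := by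
      rw [intervalIntegral.integral_eq_sub_of_hasDerivAt (fun s _ => hf s)
        (hf'.intervalIntegrable _ _), ha, sub_zero]
    have h2 : ‖f t‖ ≤ ∫ s in a..t, ‖f' s‖ := by
      rw [← h1]
      exact intervalIntegral.norm_integral_le_integral_norm ht.1
    have h3 : ∫ s in a..t, ‖f' s‖ ^ 2 ≤ ∫ s in a..b, ‖f' s‖ ^ 2 :=
      intervalIntegral.integral_mono_interval le_rfl ht.1 ht.2
        (Filter.Eventually.of_forall fun s => by positivity)
        ((hf'.norm.pow 2).intervalIntegrable _ _)
    have h4 : 0 ≤ ∫ s in a..t, ‖f' s‖ ^ 2 :=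
      intervalIntegral.integral_nonneg ht.1 fun s _ => by positivity
    calc ‖f t‖ ^ 2 ≤ (∫ s in a..t, ‖f' s‖) ^ 2 := by gcongr
      _ ≤ (t - a) * ∫ s in a..t, ‖f' s‖ ^ 2 := sq_intervalIntegral_le hf'.norm ht.1
      _ ≤ _ := mul_le_mul (by linarith [ht.2]) h3 h4 (by linarith)
  calc ∫ t in a..b, ‖f t‖ ^ 2 ≤ ∫ _ in a..b, (b - a) * ∫ s in a..b, ‖f' s‖ ^ 2 :=
        intervalIntegral.integral_mono_on hab ((hfc.norm.pow 2).intervalIntegrable _ _)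
          (by simp) key
    _ = _ := by rw [intervalIntegral.integral_const, smul_eq_mul]; ring

/-- Rotation by the angle `t` about the first coordinate axis. -/
def rotX (t : ℝ) (x : E3) : E3 :=
  !₂[x 0, Real.cos t * x 1 - Real.sin t * x 2, Real.sin t * x 1 + Real.cos t * x 2]

/-- The velocity field of the rotations about the first coordinate axis. -/
def rotXField (x : E3) : E3 := !₂[0, -x 2, x 1]

@[simp] lemma rotX_apply_zero (t : ℝ) (x : E3) : rotX t x 0 = x 0 := rfl

@[simp] lemma rotX_apply_one (t : ℝ) (x : E3) :
    rotX t x 1 = Real.cos t * x 1 - Real.sin t * x 2 := rfl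

@[simp] lemma rotX_apply_two (t : ℝ) (x : E3) :
    rotX t x 2 = Real.sin t * x 1 + Real.cos t * x 2 := rfl

lemma continuous_rotX : Continuous fun p : ℝ × E3 => rotX p.1 p.2 := by
  unfold rotX
  refine (PiLp.continuous_toLp 2 _).comp (continuous_pi fun i => ?_)
  fin_cases i <;> simp <;> fun_prop

lemma continuous_rotXField : Continuous rotXField := by
  unfold rotXField
  refine (PiLp.continuous_toLp 2 _).comp (continuous_pi fun i => ?_)
  fin_cases i <;> simp <;> fun_prop

lemma rotX_add (s t : ℝ) (x : E3) : rotX (s + t) x = rotX s (rotX t x) := by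
  ext i
  fin_cases i <;> simp [Real.cos_add, Real.sin_add] <;> ring

lemma rotX_zero (x : E3) : rotX 0 x = x := by
  ext i
  fin_cases i <;> simp

lemma mem_S2_iff (x : E3) : x ∈ S2 ↔ x 0 ^ 2 + x 1 ^ 2 + x 2 ^ 2 = 1 := by
  simp [S2, EuclideanSpace.norm_eq, Fin.sum_univ_three]

lemma isCompact_S2 : IsCompact S2 := isCompact_sphere 0 1

lemma rotX_mem_S2 {t : ℝ} {x : E3} : rotX t x ∈ S2 ↔ x ∈ S2 := by
  rw [mem_S2_iff, mem_S2_iff]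
  simp only [rotX_apply_zero, rotX_apply_one, rotX_apply_two]
  have := Real.sin_sq_add_cos_sq t
  have e : x 0 ^ 2 + (Real.cos t * x 1 - Real.sin t * x 2) ^ 2
      + (Real.sin t * x 1 + Real.cos t * x 2) ^ 2
      = x 0 ^ 2 + (Real.sin t ^ 2 + Real.cos t ^ 2) * (x 1 ^ 2 + x 2 ^ 2) := by ring
  rw [e, this, one_mul, add_assoc]

lemma isometry_rotX (t : ℝ) : Isometry (rotX t) := by
  refine Isometry.of_dist_eq fun x y => ?_
  simp only [EuclideanSpace.dist_eq, Fin.sum_univ_three, Real.dist_eq, sq_abs]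
  congr 1
  simp only [rotX_apply_zero, rotX_apply_one, rotX_apply_two]
  linear_combination ((x 1 - y 1) ^ 2 + (x 2 - y 2) ^ 2) * Real.sin_sq_add_cos_sq t

/-- Rotation about the first coordinate axis as an isometric equivalence. -/
def rotXEquiv (t : ℝ) : E3 ≃ᵢ E3 :=
  IsometryEquiv.mk' (rotX t) (rotX (-t))
    (fun x => by rw [← rotX_add, add_neg_cancel, rotX_zero]) (isometry_rotX t)

lemma setIntegral_comp_rotX (t : ℝ) (h : E3 → ℝ) :
    ∫ x in S2, h (rotX t x) ∂μH[2] = ∫ x in S2, h x ∂μH[2] := by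
  have := ((rotXEquiv t).measurePreserving_hausdorffMeasure 2).setIntegral_preimage_emb
    (rotXEquiv t).toHomeomorph.measurableEmbedding h S2
  rw [← this]
  congr 2
  ext x
  exact rotX_mem_S2.symm

lemma hasDerivAt_rotX (t : ℝ) (x : E3) :
    HasDerivAt (fun s => rotX s x) (rotXField (rotX t x)) t := by
  suffices h : HasDerivAt (fun s => (rotX s x).ofLp) (rotXField (rotX t x)).ofLp t from
    (PiLp.continuousLinearEquiv 2 ℝ fun _ : Fin 3 => ℝ).symm.hasFDerivAt.comp_hasDerivAt t h
  rw [hasDerivAt_pi]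
  intro i
  fin_cases i
  · simpa [rotX, rotXField] using hasDerivAt_const t (x 0)
  · have := ((Real.hasDerivAt_cos t).mul_const (x 1)).sub ((Real.hasDerivAt_sin t).mul_const (x 2))
    refine this.congr_deriv ?_
    simp [rotX, rotXField]
    ring
  · have := ((Real.hasDerivAt_sin t).mul_const (x 1)).add ((Real.hasDerivAt_cos t).mul_const (x 2))
    refine this.congr_deriv ?_
    simp [rotX, rotXField]
    ring

lemma norm_fderiv_rotXField_sq_le (φ : E3 → ℂ) {x : E3} (hx : x ∈ S2) :
    ‖fderiv ℝ φ x (rotXField x)‖ ^ 2 ≤ tGradSq φ x := by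
  rw [mem_S2_iff] at hx
  have hv : rotXField x = (-x 2) • tangProj x (EuclideanSpace.single 1 1)
      + x 1 • tangProj x (EuclideanSpace.single 2 1) := by
    ext i
    fin_cases i <;> simp [rotXField, tangProj, EuclideanSpace.inner_single_right] <;> ring
  rw [hv, tGradSq, Fin.sum_univ_three, map_add, map_smul, map_smul]
  set A := fderiv ℝ φ x (tangProj x (EuclideanSpace.single 1 1))
  set B := fderiv ℝ φ x (tangProj x (EuclideanSpace.single 2 1))
  have h1 : ‖(-x 2) • A + x 1 • B‖ ≤ |x 2| * ‖A‖ + |x 1| * ‖B‖ := by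
    refine (norm_add_le _ _).trans_eq ?_
    simp
  have h2 : (|x 2| * ‖A‖ + |x 1| * ‖B‖) ^ 2 ≤ (x 1 ^ 2 + x 2 ^ 2) * (‖A‖ ^ 2 + ‖B‖ ^ 2) := by
    rw [← sq_abs (x 1), ← sq_abs (x 2)]
    nlinarith [sq_nonneg (|x 2| * ‖B‖ - |x 1| * ‖A‖)]
  have h3 : (x 1 ^ 2 + x 2 ^ 2) * (‖A‖ ^ 2 + ‖B‖ ^ 2) ≤ 1 * (‖A‖ ^ 2 + ‖B‖ ^ 2) := by
    gcongr
    nlinarith [sq_nonneg (x 0)]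
  have h4 : ‖(-x 2) • A + x 1 • B‖ ^ 2 ≤ (|x 2| * ‖A‖ + |x 1| * ‖B‖) ^ 2 := by gcongr
  linarith [sq_nonneg ‖fderiv ℝ φ x (tangProj x (EuclideanSpace.single 0 1))‖]

lemma Antisym.eq_zero {φ : E3 → ℂ} (hanti : Antisym φ) {x : E3} (hx : x ∈ S2) (h : x 2 = 0) :
    φ x = 0 := by
  have hn : negz x = x := by
    ext i
    fin_cases i <;> simp [negz, h]
  have := hanti x hx
  rw [hn] at this
  exact self_eq_neg.1 this

lemma exists_rotX_apply_two_eq_zero (x : E3) : ∃ a, rotX a x 2 = 0 := by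
  have hc : ContinuousOn (fun t => rotX t x 2) (Set.uIcc 0 Real.pi) := by
    simp only [rotX_apply_two]
    fun_prop
  obtain ⟨a, -, ha⟩ := intermediate_value_uIcc hc (show (0 : ℝ) ∈ _ by
    simp only [rotX_apply_two, Real.sin_zero, Real.cos_zero, Real.sin_pi, Real.cos_pi]
    rw [Set.mem_uIcc]
    rcases le_total 0 (x 2) with h | h
    · right; constructor <;> linarith
    · left; constructor <;> linarith)
  exact ⟨a, ha⟩

/-- The Poincaré inequality on the circles around the first coordinate axis. -/
lemma integral_circle_le {φ : E3 → ℂ} (hφ : ContDiff ℝ 1 φ) (hanti : Antisym φ) {x : E3}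
    (hx : x ∈ S2) :
    ∫ t in (0 : ℝ)..2 * Real.pi, ‖φ (rotX t x)‖ ^ 2 ≤
      16 * ∫ t in (0 : ℝ)..2 * Real.pi,
        ‖fderiv ℝ φ (rotX t x) (rotXField (rotX t x))‖ ^ 2 := by
  obtain ⟨a, ha⟩ := exists_rotX_apply_two_eq_zero x
  have hpi := Real.pi_pos
  have hrot : Continuous fun t => rotX t x :=
    continuous_rotX.comp (continuous_id.prodMk continuous_const)
  set f : ℝ → ℂ := fun t => φ (rotX t x)
  set f' : ℝ → ℂ := fun t => fderiv ℝ φ (rotX t x) (rotXField (rotX t x))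
  have hd : ∀ t, HasDerivAt f (f' t) t := fun t =>
    ((hφ.differentiable one_ne_zero).differentiableAt.hasFDerivAt).comp_hasDerivAt t
      (hasDerivAt_rotX t x)
  have hfc : Continuous f := hφ.continuous.comp hrot
  have hf'c : Continuous f' :=
    ((hφ.continuous_fderiv one_ne_zero).comp hrot).clm_apply (continuous_rotXField.comp hrot)
  have hper : ∀ t, rotX (t + 2 * Real.pi) x = rotX t x := fun t => by simp [rotX]
  have p1 : Function.Periodic (fun t => ‖f t‖ ^ 2) (2 * Real.pi) := fun t => by simp [f, hper]
  have p2 : Function.Periodic (fun t => ‖f' t‖ ^ 2) (2 * Real.pi) := fun t => by simp [f', hper]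
  have e1 := p1.intervalIntegral_add_eq 0 a
  have e2 := p2.intervalIntegral_add_eq 0 a
  rw [zero_add] at e1 e2
  have z1 : f a = 0 := hanti.eq_zero (rotX_mem_S2.2 hx) ha
  have z2 : f (a + Real.pi) = 0 := hanti.eq_zero (rotX_mem_S2.2 hx) (by
    rw [rotX_apply_two] at ha ⊢
    rw [Real.sin_add_pi, Real.cos_add_pi]
    linarith)
  have b1 := intervalIntegral_norm_sq_le hd hf'c (b := a + Real.pi) (by linarith) z1
  have b2 := intervalIntegral_norm_sq_le hd hf'c (b := a + 2 * Real.pi) (by linarith) z2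
  have s1 := intervalIntegral.integral_add_adjacent_intervals
    ((hfc.norm.pow 2).intervalIntegrable (μ := volume) a (a + Real.pi))
    ((hfc.norm.pow 2).intervalIntegrable (a + Real.pi) (a + 2 * Real.pi))
  have s2 := intervalIntegral.integral_add_adjacent_intervals
    ((hf'c.norm.pow 2).intervalIntegrable (μ := volume) a (a + Real.pi))
    ((hf'c.norm.pow 2).intervalIntegrable (a + Real.pi) (a + 2 * Real.pi))
  change ∫ t in (0 : ℝ)..2 * Real.pi, ‖f t‖ ^ 2 ≤ 16 * ∫ t in (0 : ℝ)..2 * Real.pi, ‖f' t‖ ^ 2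
  rw [show a + Real.pi - a = Real.pi by ring] at b1
  rw [show a + 2 * Real.pi - (a + Real.pi) = Real.pi by ring] at b2
  simp only [Pi.pow_apply] at s1 s2
  rw [e1, e2, ← s1, ← s2]
  have n1 : 0 ≤ ∫ t in a..a + Real.pi, ‖f' t‖ ^ 2 :=
    intervalIntegral.integral_nonneg (by linarith) fun s _ => by positivity
  have n2 : 0 ≤ ∫ t in a + Real.pi..a + 2 * Real.pi, ‖f' t‖ ^ 2 :=
    intervalIntegral.integral_nonneg (by linarith) fun s _ => by positivity
  have hpi16 : Real.pi ^ 2 ≤ 16 := by nlinarith [Real.pi_le_four]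
  nlinarith [mul_le_mul_of_nonneg_right hpi16 n1, mul_le_mul_of_nonneg_right hpi16 n2]

/-- Spherical coordinates. -/
def sphericalCoord (p : Fin 2 → ℝ) : E3 :=
  !₂[Real.cos (p 1) * Real.cos (p 0), Real.cos (p 1) * Real.sin (p 0), Real.sin (p 1)]

lemma contDiff_sphericalCoord : ContDiff ℝ 1 sphericalCoord := by
  rw [contDiff_euclidean]
  intro i
  fin_cases i <;> simp [sphericalCoord] <;> fun_prop

lemma S2_subset_image_sphericalCoord :
    S2 ⊆ sphericalCoord '' Set.Icc (fun _ => -Real.pi) (fun _ => Real.pi) := by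
  intro x hx
  rw [mem_S2_iff] at hx
  set z : ℂ := ⟨x 0, x 1⟩
  set w : ℂ := ⟨‖z‖, x 2⟩
  have hz : ‖z‖ ^ 2 = x 0 ^ 2 + x 1 ^ 2 := by
    rw [Complex.sq_norm, Complex.normSq_apply]; ring
  have hw : ‖w‖ = 1 := by
    have : ‖w‖ ^ 2 = 1 := by
      rw [Complex.sq_norm, Complex.normSq_apply, ← hx, ← hz]; ring
    exact (pow_eq_one_iff_of_nonneg (norm_nonneg w) two_ne_zero).1 this
  have c1 := Complex.norm_mul_cos_arg z
  have c2 := Complex.norm_mul_sin_arg z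
  have c3 := Complex.norm_mul_cos_arg w
  have c4 := Complex.norm_mul_sin_arg w
  rw [hw, one_mul] at c3 c4
  refine ⟨![z.arg, w.arg], ⟨fun i => ?_, fun i => ?_⟩, ?_⟩
  · fin_cases i
    · exact (Complex.neg_pi_lt_arg z).le
    · exact (Complex.neg_pi_lt_arg w).le
  · fin_cases i
    · exact Complex.arg_le_pi z
    · exact Complex.arg_le_pi w
  · ext i
    fin_cases i
    · exact (congrArg (· * Real.cos z.arg) c3).trans c1
    · exact (congrArg (· * Real.sin z.arg) c3).trans c2
    · simpa [sphericalCoord] using c4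

lemma hausdorffMeasure_S2_lt_top : (μH[2] : Measure E3) S2 < ⊤ := by
  obtain ⟨K, hK⟩ := contDiff_sphericalCoord.locallyLipschitz.locallyLipschitzOn
    (s := Set.Icc (fun _ => -Real.pi) (fun _ => Real.pi)) |>.exists_lipschitzOnWith_of_compact
    isCompact_Icc
  refine (measure_mono S2_subset_image_sphericalCoord).trans_lt
    ((hK.hausdorffMeasure_image_le (by norm_num : (0 : ℝ) ≤ 2)).trans_lt ?_)
  have h := hausdorffMeasure_pi_real (ι := Fin 2)
  simp only [Fintype.card_fin, Nat.cast_ofNat] at h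
  rw [h]
  exact ENNReal.mul_lt_top (ENNReal.rpow_lt_top_of_nonneg (by norm_num) ENNReal.coe_ne_top)
    isCompact_Icc.measure_lt_top

instance isFiniteMeasure_restrict_S2 : IsFiniteMeasure ((μH[2] : Measure E3).restrict S2) :=
  ⟨by simpa using hausdorffMeasure_S2_lt_top⟩

lemma integrableOn_S2 {h : E3 → ℝ} (hh : Continuous h) :
    Integrable h ((μH[2] : Measure E3).restrict S2) := by
  have := hh.continuousOn.integrableOn_compact (μ := (μH[2] : Measure E3).restrict S2) isCompact_S2
  rwa [IntegrableOn, Measure.restrict_restrict isCompact_S2.measurableSet, Set.inter_self] at this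

lemma integrable_prod_rotX {h : E3 → ℝ} (hh : Continuous h) (b : ℝ) :
    Integrable (Function.uncurry fun (x : E3) (t : ℝ) => h (rotX t x))
      (((μH[2] : Measure E3).restrict S2).prod (volume.restrict (Set.Ioc 0 b))) := by
  have hc : Continuous (Function.uncurry fun (x : E3) (t : ℝ) => h (rotX t x)) :=
    hh.comp (continuous_rotX.comp continuous_swap)
  have := hc.continuousOn.integrableOn_compact
    (μ := ((μH[2] : Measure E3).restrict S2).prod volume)
    (isCompact_S2.prod (isCompact_Icc (a := (0 : ℝ)) (b := b)))
  rw [IntegrableOn, ← Measure.prod_restrict, Measure.restrict_restrict isCompact_S2.measurableSet,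
    Set.inter_self] at this
  rwa [restrict_Ioc_eq_restrict_Icc]

/-- Averaging over the rotations about the first axis does not change the integral over `S2`. -/
lemma integral_integral_rotX {h : E3 → ℝ} (hh : Continuous h) {b : ℝ} (hb : 0 ≤ b) :
    ∫ x in S2, (∫ t in (0 : ℝ)..b, h (rotX t x)) ∂μH[2] = b * ∫ x in S2, h x ∂μH[2] := by
  simp_rw [intervalIntegral.integral_of_le hb]
  rw [integral_integral_swap (integrable_prod_rotX hh b)]
  simp_rw [setIntegral_comp_rotX]
  simp [hb]

lemma continuous_tGradSq {φ : E3 → ℂ} (hφ : ContDiff ℝ 1 φ) : Continuous (tGradSq φ) := by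
  have := hφ.continuous_fderiv one_ne_zero
  unfold tGradSq tangProj
  fun_prop

/-- Poincaré-type inequality on `𝕊²`. If `φ` is `C¹` and antisymmetric
about the equator, then `∫_{𝕊²}|φ|² dσ ≤ 16 ∫_{𝕊²}|∇_{𝕊²}φ|² dσ`, where `σ = μH[2]` is the
surface (2-dimensional Hausdorff) measure on the sphere. -/
theorem sphere_antisym_poincare (φ : E3 → ℂ) (hφ : ContDiff ℝ 1 φ) (hanti : Antisym φ) :
    ∫ x in S2, ‖φ x‖ ^ 2 ∂μH[2] ≤ 16 * ∫ x in S2, tGradSq φ x ∂μH[2] := by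
  have hpi : 0 < 2 * Real.pi := Real.two_pi_pos
  have hc1 : Continuous fun x => ‖φ x‖ ^ 2 := hφ.continuous.norm.pow 2
  have hc2 : Continuous fun x => ‖fderiv ℝ φ x (rotXField x)‖ ^ 2 :=
    ((hφ.continuous_fderiv one_ne_zero).clm_apply continuous_rotXField).norm.pow 2
  have integrable_average {h : E3 → ℝ} (hh : Continuous h) :
      Integrable (fun x => ∫ t in (0 : ℝ)..2 * Real.pi, h (rotX t x))
        ((μH[2] : Measure E3).restrict S2) := by
    simp_rw [intervalIntegral.integral_of_le hpi.le]
    exact (integrable_prod_rotX hh _).integral_prod_left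
  have hle : ∫ x in S2, (∫ t in (0 : ℝ)..2 * Real.pi, ‖φ (rotX t x)‖ ^ 2) ∂μH[2] ≤
      ∫ x in S2, (16 * ∫ t in (0 : ℝ)..2 * Real.pi,
        ‖fderiv ℝ φ (rotX t x) (rotXField (rotX t x))‖ ^ 2) ∂μH[2] :=
    setIntegral_mono_on (integrable_average hc1) ((integrable_average hc2).const_mul 16)
      isCompact_S2.measurableSet fun x hx => integral_circle_le hφ hanti hx
  rw [integral_const_mul, integral_integral_rotX hc1 hpi.le, integral_integral_rotX hc2 hpi.le]
    at hle
  have hgrad : ∫ x in S2, ‖fderiv ℝ φ x (rotXField x)‖ ^ 2 ∂μH[2] ≤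
      ∫ x in S2, tGradSq φ x ∂μH[2] :=
    setIntegral_mono_on (integrableOn_S2 hc2) (integrableOn_S2 (continuous_tGradSq hφ))
      isCompact_S2.measurableSet fun x hx => norm_fderiv_rotXField_sq_le φ hx
  refine le_trans (le_of_mul_le_mul_left ?_ hpi) (mul_le_mul_of_nonneg_left hgrad (by norm_num))
  linarith

end
end
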